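/- Let X be a nonempty compact metric space and f : X → X a continuous surjective map. For every f-invariant Borel probability measure μ on X (i.e. the pushforward of μ by f equals μ) there exists a unique f̃-invariant Borel probability measure μ̃ on X_f such that π_* μ̃ = μ. -/

import Mathlib

open Function Set MeasureTheory

/-- The inverse limit (natural extension) of a map `f : X → X`, with the subspace
topology induced by the product topology on `X^ℤ`. -/
def InvLimit {X : Type*} (f : X → X) : Set (ℤ → X) :=
  {x | ∀ k : ℤ, f (x k) = x (k + 1)}

/-- The projection `π : X_f → X` onto the 0-th coordinate. -/
def InvLimit.proj {X : Type*} (f : X → X) (x : InvLimit f) : X := x.1 0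

/-- The shift map `f̃ : X_f → X_f`, `(f̃ x̃)_k = x_{k+1}`. -/
def InvLimit.shift {X : Type*} (f : X → X) (x : InvLimit f) : InvLimit f :=
  ⟨fun k => x.1 (k + 1), fun k => x.2 (k + 1)⟩

/-- We equip `X_f` with its Borel σ-algebra. -/
noncomputable instance {X : Type*} [MetricSpace X] (f : X → X) :
    MeasurableSpace (InvLimit f) := borel _

instance {X : Type*} [MetricSpace X] (f : X → X) : BorelSpace (InvLimit f) := ⟨rfl⟩

open Filter Topology

namespace InvLimit

variable {X : Type*} {f : X → X}

theorem iterate_apply (x : InvLimit f) (k : ℤ) (n : ℕ) : f^[n] (x.1 k) = x.1 (k + n) := by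
  induction n with
  | zero => simp
  | succ n ih =>
    rw [Function.iterate_succ_apply', ih, x.2]
    push_cast
    ring_nf

theorem shift_iterate_apply (x : InvLimit f) (k : ℤ) (n : ℕ) :
    ((shift f)^[n] x).1 k = x.1 (k + n) := by
  induction n generalizing x with
  | zero => simp
  | succ n ih =>
    rw [Function.iterate_succ_apply, ih]
    change x.1 (k + n + 1) = _
    push_cast
    ring_nf

/-- A sequence that follows the orbit of `x` from time `-n` on. -/
def approx (f : X → X) (n : ℕ) (x : X) : ℤ → X := fun k => f^[(k + n).toNat] x

theorem apply_approx {n : ℕ} {k : ℤ} (h : -k ≤ n) (x : X) :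
    f (approx f n x k) = approx f n x (k + 1) := by
  have hk : (k + 1 + n).toNat = (k + n).toNat + 1 := by omega
  simp only [approx, hk, Function.iterate_succ_apply']

section Topological

variable [MetricSpace X]

theorem isClosed (hf : Continuous f) : IsClosed (InvLimit f) := by
  have h : InvLimit f = ⋂ k : ℤ, {x | f (x k) = x (k + 1)} := by
    ext x
    simp [InvLimit]
  rw [h]
  exact isClosed_iInter fun k =>
    isClosed_eq (hf.comp (continuous_apply k)) (continuous_apply (k + 1))

theorem continuous_coord (k : ℤ) : Continuous fun x : InvLimit f => x.1 k :=
  (continuous_apply k).comp continuous_subtype_val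

theorem continuous_shift : Continuous (shift f) :=
  Continuous.subtype_mk (continuous_pi fun k => continuous_coord (k + 1)) _

theorem continuous_approx (hf : Continuous f) (n : ℕ) : Continuous (approx f n) :=
  continuous_pi fun _ => hf.iterate _

variable [MeasurableSpace X] [BorelSpace X]

/-- The σ-algebras generated by single coordinates decrease as the index increases. -/
theorem antitone_comap_coord (hf : Continuous f) :
    Antitone fun k : ℤ =>
      MeasurableSpace.comap (fun x : InvLimit f => x.1 k) (inferInstance : MeasurableSpace X) := by
  intro k j hkj
  obtain ⟨n, rfl⟩ := Int.le.dest hkj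
  rintro _ ⟨s, hs, rfl⟩
  refine ⟨f^[n] ⁻¹' s, (hf.measurable.iterate n) hs, ?_⟩
  ext x
  simp [iterate_apply]

theorem map_coord_of_map_shift_eq {ν : Measure (InvLimit f)} (hν : ν.map (shift f) = ν) (k : ℤ) :
    ν.map (fun x => x.1 k) = ν.map (proj f) := by
  have hiter (n : ℕ) : MeasurePreserving (shift f)^[n] ν ν :=
    MeasurePreserving.iterate ⟨continuous_shift.measurable, hν⟩ n
  have hadd (j : ℤ) (n : ℕ) : ν.map (fun x => x.1 (j + n)) = ν.map (fun x => x.1 j) := by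
    conv_rhs => rw [← (hiter n).map_eq]
    rw [Measure.map_map (continuous_coord j).measurable (hiter n).measurable]
    congr 1
    ext x
    simp [shift_iterate_apply]
  change _ = ν.map (fun x => x.1 0)
  obtain ⟨n, rfl | rfl⟩ := k.eq_nat_or_neg
  · simpa using hadd 0 n
  · simpa using (hadd (-n) n).symm

variable [CompactSpace X]

theorem measurableSpace_eq_iSup :
    (inferInstance : MeasurableSpace (InvLimit f)) =
      ⨆ k : ℤ, MeasurableSpace.comap (fun x : InvLimit f => x.1 k) inferInstance := by
  have h : (inferInstance : MeasurableSpace (InvLimit f)) =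
      MeasurableSpace.comap Subtype.val (inferInstance : MeasurableSpace (ℤ → X)) :=
    borel_comap.trans (congrArg (MeasurableSpace.comap Subtype.val)
      (BorelSpace.measurable_eq (α := ℤ → X)).symm)
  rw [h]
  change MeasurableSpace.comap Subtype.val (⨆ k : ℤ, _) = _
  simp only [MeasurableSpace.comap_iSup, MeasurableSpace.comap_comp]
  rfl

/-- A finite measure on the inverse limit is determined by its one-dimensional marginals. -/
theorem measure_ext (hf : Continuous f) {ν₁ ν₂ : Measure (InvLimit f)} [IsFiniteMeasure ν₁]
    (h : ∀ k : ℤ, ν₁.map (fun x => x.1 k) = ν₂.map (fun x => x.1 k)) : ν₁ = ν₂ := by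
  have key : ∀ (k : ℤ) (s : Set X), MeasurableSet s →
      ν₁ ((fun x : InvLimit f => x.1 k) ⁻¹' s) = ν₂ ((fun x : InvLimit f => x.1 k) ⁻¹' s) := by
    intro k s hs
    rw [← Measure.map_apply (continuous_coord k).measurable hs, h k,
      Measure.map_apply (continuous_coord k).measurable hs]
  refine ext_of_generate_finite
    (⋃ k : ℤ, {t | MeasurableSet[MeasurableSpace.comap (fun x : InvLimit f => x.1 k)
      inferInstance] t}) ?_ ?_ ?_ ?_
  · exact measurableSpace_eq_iSup.trans
      (MeasurableSpace.generateFrom_iUnion_measurableSet _).symm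
  · refine isPiSystem_iUnion_of_directed_le _ (fun k => ?_) ?_
    · exact @MeasurableSpace.isPiSystem_measurableSet _ (MeasurableSpace.comap _ _)
    · exact (antitone_comap_coord hf).directed_le
  · intro t ht
    obtain ⟨k, s, hs, rfl⟩ := mem_iUnion.1 ht
    exact key k s hs
  · simpa using key 0 univ MeasurableSet.univ

/-- An invariant measure is the common marginal of a measure on `ℤ → X` concentrated on the
inverse limit. -/
theorem exists_measure_pi (hf : Continuous f) (μ : Measure X) [IsProbabilityMeasure μ]
    (hinv : μ.map f = μ) :
    ∃ ν : Measure (ℤ → X), IsProbabilityMeasure ν ∧ (∀ᵐ x ∂ν, x ∈ InvLimit f) ∧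
      ∀ k : ℤ, ν.map (fun x => x k) = μ := by
  let P : ProbabilityMeasure X := ⟨μ, inferInstance⟩
  let νs : ℕ → ProbabilityMeasure (ℤ → X) := fun n =>
    P.map (continuous_approx hf n).measurable.aemeasurable
  obtain ⟨ν, hν⟩ := exists_clusterPt_of_compactSpace (map νs atTop)
  obtain ⟨U, hU, hUν⟩ := mapClusterPt_iff_ultrafilter.1 hν
  refine ⟨ν, inferInstance, ?_, fun k => ?_⟩
  · refine ae_all_iff.2 fun k => ?_
    have hclosed : IsClosed {x : ℤ → X | f (x k) = x (k + 1)} :=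
      isClosed_eq (hf.comp (continuous_apply k)) (continuous_apply (k + 1))
    have hlim := ProbabilityMeasure.limsup_measure_closed_le_of_tendsto hUν hclosed
    have hone : ∀ᶠ n in (U : Filter ℕ),
        (νs n : Measure (ℤ → X)) {x : ℤ → X | f (x k) = x (k + 1)} = 1 := by
      filter_upwards [hU (eventually_ge_atTop (-k).toNat)] with n hn
      have hn' : -k ≤ n := by simpa using hn
      rw [ProbabilityMeasure.toMeasure_map,
        Measure.map_apply (continuous_approx hf n).measurable hclosed.measurableSet]
      have : approx f n ⁻¹' {x : ℤ → X | f (x k) = x (k + 1)} = univ :=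
        eq_univ_of_forall fun x => apply_approx hn' x
      rw [this, measure_univ]
    rw [limsup_congr hone, limsup_const] at hlim
    exact (prob_compl_eq_zero_iff hclosed.measurableSet).2 (le_antisymm prob_le_one hlim)
  · have hlim := ProbabilityMeasure.tendsto_map_of_tendsto_of_continuous _ _ hUν
      (continuous_apply (A := fun _ : ℤ => X) k)
    have hconst : ∀ n, (νs n).map (continuous_apply (A := fun _ : ℤ => X)
        k).measurable.aemeasurable = P := by
      intro n
      apply Subtype.ext
      change (μ.map (approx f n)).map (fun x => x k) = μ
      rw [Measure.map_map (measurable_pi_apply k) (continuous_approx hf n).measurable]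
      exact (MeasurePreserving.iterate ⟨hf.measurable, hinv⟩ (k + n).toNat).map_eq
    simp only [hconst] at hlim
    have heq := tendsto_nhds_unique hlim tendsto_const_nhds
    exact congrArg Subtype.val heq

/-- An invariant measure is the common marginal of a measure on the inverse limit. -/
theorem exists_measure (hf : Continuous f) (μ : Measure X) [IsProbabilityMeasure μ]
    (hinv : μ.map f = μ) :
    ∃ ν : Measure (InvLimit f), IsProbabilityMeasure ν ∧ ∀ k : ℤ, ν.map (fun x => x.1 k) = μ := by
  obtain ⟨ν, hν, hmem, hmarg⟩ := exists_measure_pi hf μ hinv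
  have hemb : MeasurableEmbedding (Subtype.val : InvLimit f → ℤ → X) :=
    (isClosed hf).isClosedEmbedding_subtypeVal.measurableEmbedding
  have hmap : (ν.comap Subtype.val).map (Subtype.val : InvLimit f → ℤ → X) = ν := by
    rw [hemb.map_comap, Subtype.range_coe]
    exact Measure.restrict_eq_self_of_ae_mem hmem
  have hcoord (k : ℤ) : (ν.comap Subtype.val).map (fun x : InvLimit f => x.1 k) = μ := by
    rw [← hmarg k, ← hmap, Measure.map_map (measurable_pi_apply k) hemb.measurable, hmap]
    rfl
  refine ⟨ν.comap Subtype.val, ⟨?_⟩, hcoord⟩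
  rw [← preimage_univ (f := fun x : InvLimit f => x.1 0),
    ← Measure.map_apply (continuous_coord 0).measurable MeasurableSet.univ, hcoord, measure_univ]

end Topological

end InvLimit

/-- For every `f`-invariant Borel probability measure `μ` on `X` there is a unique
`f̃`-invariant Borel probability measure `μ̃` on `X_f` with `π_* μ̃ = μ`. -/
theorem stmt4 {X : Type*} [MetricSpace X] [CompactSpace X] [Nonempty X]
    [MeasurableSpace X] [BorelSpace X]
    (f : X → X) (hf : Continuous f) (hsurj : Function.Surjective f)
    (μ : Measure X) [IsProbabilityMeasure μ] (hinv : μ.map f = μ) :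
    ∃! μt : Measure (InvLimit f),
      IsProbabilityMeasure μt ∧ μt.map (InvLimit.shift f) = μt ∧
        μt.map (InvLimit.proj f) = μ := by
  obtain ⟨ν, hν, hmarg⟩ := InvLimit.exists_measure hf μ hinv
  refine ⟨ν, ⟨hν, ?_, hmarg 0⟩, ?_⟩
  · refine (InvLimit.measure_ext hf fun k => ?_).symm
    rw [Measure.map_map (InvLimit.continuous_coord k).measurable
      InvLimit.continuous_shift.measurable, hmarg k]
    exact (hmarg (k + 1)).symm
  · rintro ν' ⟨hν', hshift, hproj⟩
    refine InvLimit.measure_ext hf fun k => ?_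
    rw [InvLimit.map_coord_of_map_shift_eq hshift, hproj, hmarg k]
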